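/- Let u ∈ 𝒮(ℝ^N) and s ∈ (0,1). Then ∫_{ℝ^N} ⟨x, ∇u(x)⟩ (−Δ)^s u(x) dx = ((2s − N)/2) ∫_{ℝ^N} u (−Δ)^s u dx. -/

import Mathlib

open MeasureTheory FourierTransform

/-- The fractional Laplacian of order `s`, defined via the Fourier transform as
`(-Δ)^s u = 𝓕⁻(|ξ|^{2s} 𝓕 u)`. -/
noncomputable def fracLap {N : ℕ} (s : ℝ) (u : EuclideanSpace ℝ (Fin N) → ℂ) :
    EuclideanSpace ℝ (Fin N) → ℂ :=
  𝓕⁻ (fun ξ => (‖ξ‖ ^ (2 * s) : ℝ) * 𝓕 u ξ)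

section

variable {V : Type*} [NormedAddCommGroup V] [InnerProductSpace ℝ V] [FiniteDimensional ℝ V]
  [MeasurableSpace V] [BorelSpace V]

/-- The inverse Fourier transform is symmetric for the bilinear pairing `∫ f g`. -/
theorem integral_mul_fourierInv_eq {f g : V → ℂ} (hf : Integrable f) (hg : Integrable g) :
    ∫ x, f x * 𝓕⁻ g x = ∫ ξ, 𝓕⁻ f ξ * g ξ := by
  have hL : Continuous fun p : V × V => (-innerₗ V) p.1 p.2 := by
    simp only [LinearMap.neg_apply, innerₗ_apply_apply]
    fun_prop
  have h := VectorFourier.integral_fourierIntegral_smul_eq_flip (L := -innerₗ V)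
    Real.continuous_fourierChar hL hf hg
  have hflip : (-innerₗ V).flip = -innerₗ V := by
    ext x y
    simp [real_inner_comm]
  rw [hflip] at h
  exact h.symm

theorem fourierInv_comp_smul (f : V → ℂ) {c : ℝ} (hc : c ≠ 0) (ξ : V) :
    𝓕⁻ (fun x => f (c • x)) ξ = |(c ^ Module.finrank ℝ V)⁻¹| • 𝓕 f (c⁻¹ • -ξ) := by
  rw [Real.fourierInv_eq, Real.fourier_eq, ← Measure.integral_comp_smul]
  congr 1 with x
  simp [inner_smul_left, inner_smul_right, hc]

theorem continuous_fourierInv {f : V → ℂ} (hf : Integrable f) : Continuous (𝓕⁻ f) :=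
  VectorFourier.fourierIntegral_continuous Real.continuous_fourierChar
    (by simp only [LinearMap.neg_apply, innerₗ_apply_apply]; fun_prop) hf

theorem norm_fourierInv_le (f : V → ℂ) (x : V) : ‖𝓕⁻ f x‖ ≤ ∫ ξ, ‖f ξ‖ :=
  VectorFourier.norm_fourierIntegral_le_integral_norm _ _ _ _ _

theorem integrable_norm_rpow_mul {a : ℝ} (ha : a ∈ Set.Icc (0 : ℝ) 2) (v : SchwartzMap V ℂ) :
    Integrable fun ξ => ((‖ξ‖ ^ a : ℝ) : ℂ) * v ξ := by
  have hcont : Continuous fun ξ : V => ((‖ξ‖ ^ a : ℝ) : ℂ) * v ξ :=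
    (Complex.continuous_ofReal.comp
      (continuous_norm.rpow_const fun _ => Or.inr ha.1)).mul v.continuous
  refine ((v.integrable_pow_mul volume 0).add (v.integrable_pow_mul volume 2)).mono'
    hcont.aestronglyMeasurable (Filter.Eventually.of_forall fun ξ => ?_)
  have hpow : ‖ξ‖ ^ a ≤ 1 + ‖ξ‖ ^ 2 := by
    rcases le_total ‖ξ‖ 1 with h | h
    · have := Real.rpow_le_one (norm_nonneg ξ) h ha.1
      nlinarith [sq_nonneg ‖ξ‖]
    · have := Real.rpow_le_rpow_of_exponent_le h ha.2
      rw [Real.rpow_two] at this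
      linarith
  have hnn : 0 ≤ ‖ξ‖ ^ a := Real.rpow_nonneg (norm_nonneg _) _
  simp only [norm_mul, Complex.norm_real, Real.norm_eq_abs, abs_of_nonneg hnn, Pi.add_apply,
    pow_zero, one_mul]
  nlinarith [norm_nonneg (v ξ)]

/-- Differentiating the dilations of a Schwartz function under the integral sign, against a
bounded continuous weight. -/
theorem hasDerivAt_integral_comp_smul_mul (u : SchwartzMap V ℂ) {w : V → ℂ} (hw : Continuous w)
    {C : ℝ} (hC : ∀ x, ‖w x‖ ≤ C) :
    HasDerivAt (fun c : ℝ => ∫ x, u (c • x) * w x) (∫ x, fderiv ℝ u x x * w x) 1 := by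
  have hdu : Continuous (fderiv ℝ u) := (u.smooth 1).continuous_fderiv one_ne_zero
  set n : ℕ := Module.finrank ℝ V with hn
  obtain ⟨A, hA⟩ : ∃ A : ℝ, ∀ x, (1 + ‖x‖) ^ (n + 2) * ‖fderiv ℝ u x‖ ≤ A := by
    simp only [← norm_iteratedFDeriv_one]
    exact ⟨_, SchwartzMap.one_add_le_sup_seminorm_apply (𝕜 := ℝ) (m := (n + 2, 1))
      le_rfl le_rfl u⟩
  have hC0 : 0 ≤ C := (norm_nonneg _).trans (hC 0)
  have hbound : Integrable fun x : V => (2 ^ (n + 2) * A * C) * (1 + ‖x‖) ^ (-(n + 1 : ℝ)) :=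
    (integrable_one_add_norm (by rw [← hn]; linarith)).const_mul _
  have key := hasDerivAt_integral_of_dominated_loc_of_deriv_le (μ := (volume : Measure V))
    (F := fun (c : ℝ) x => u (c • x) * w x)
    (F' := fun (c : ℝ) x => fderiv ℝ u (c • x) x * w x) (x₀ := 1)
    (s := Metric.ball 1 (1 / 2)) (Metric.ball_mem_nhds _ (by norm_num))
    (Filter.Eventually.of_forall fun c =>
      ((u.continuous.comp (continuous_const_smul c)).mul hw).aestronglyMeasurable)
    (by simpa using u.integrable.mul_bdd (c := C) hw.aestronglyMeasurable
          (Filter.Eventually.of_forall hC))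
    (by
      simp only [one_smul]
      exact ((hdu.clm_apply continuous_id).mul hw).aestronglyMeasurable)
    (Filter.Eventually.of_forall fun x c hc => ?_) hbound
    (Filter.Eventually.of_forall fun x c _ => ?_)
  · simpa using key.2
  · rw [Metric.mem_ball, Real.dist_eq, abs_lt] at hc
    have hle : 1 + ‖x‖ ≤ 2 * (1 + ‖c • x‖) := by
      rw [norm_smul, Real.norm_eq_abs, abs_of_pos (by linarith)]
      nlinarith [norm_nonneg x]
    have hdecay : (1 + ‖x‖) ^ (n + 1) * (‖fderiv ℝ u (c • x)‖ * ‖x‖) ≤ 2 ^ (n + 2) * A :=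
      calc (1 + ‖x‖) ^ (n + 1) * (‖fderiv ℝ u (c • x)‖ * ‖x‖)
          ≤ (1 + ‖x‖) ^ (n + 1) * (‖fderiv ℝ u (c • x)‖ * (1 + ‖x‖)) := by gcongr; linarith
        _ = (1 + ‖x‖) ^ (n + 2) * ‖fderiv ℝ u (c • x)‖ := by ring
        _ ≤ (2 * (1 + ‖c • x‖)) ^ (n + 2) * ‖fderiv ℝ u (c • x)‖ := by gcongr
        _ = 2 ^ (n + 2) * ((1 + ‖c • x‖) ^ (n + 2) * ‖fderiv ℝ u (c • x)‖) := by
          rw [mul_pow, mul_assoc]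
        _ ≤ 2 ^ (n + 2) * A := by gcongr; exact hA _
    have hrpow : (1 + ‖x‖) ^ (-(n + 1 : ℝ)) = ((1 + ‖x‖) ^ (n + 1))⁻¹ := by
      rw [Real.rpow_neg (by positivity)]
      norm_cast
    rw [hrpow, norm_mul, ← div_eq_mul_inv, le_div_iff₀ (by positivity)]
    calc ‖fderiv ℝ u (c • x) x‖ * ‖w x‖ * (1 + ‖x‖) ^ (n + 1)
        ≤ ‖fderiv ℝ u (c • x)‖ * ‖x‖ * C * (1 + ‖x‖) ^ (n + 1) := by
          gcongr
          · exact ContinuousLinearMap.le_opNorm _ _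
          · exact hC x
      _ = (1 + ‖x‖) ^ (n + 1) * (‖fderiv ℝ u (c • x)‖ * ‖x‖) * C := by ring
      _ ≤ 2 ^ (n + 2) * A * C := by gcongr
  · have hsmul : HasDerivAt (fun c : ℝ => c • x) x c := by
      simpa using (hasDerivAt_id c).smul_const x
    exact ((u.differentiableAt.hasFDerivAt).comp_hasDerivAt c hsmul).mul_const _

end

section

variable {N : ℕ} {s : ℝ}

local notation "𝔼" => EuclideanSpace ℝ (Fin N)

theorem integral_comp_smul_mul_fracLap (hs : s ∈ Set.Icc (0 : ℝ) 1) (u : SchwartzMap 𝔼 ℂ)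
    {c : ℝ} (hc : 0 < c) :
    ∫ x, u (c • x) * fracLap s u x =
      ((c ^ N)⁻¹ : ℝ) • ∫ ξ : 𝔼, 𝓕 (⇑u) (c⁻¹ • -ξ) * ((‖ξ‖ ^ (2 * s) : ℝ) * 𝓕 (⇑u) ξ) := by
  have hg : Integrable fun ξ : 𝔼 => ((‖ξ‖ ^ (2 * s) : ℝ) : ℂ) * 𝓕 (⇑u) ξ :=
    integrable_norm_rpow_mul ⟨by linarith [hs.1], by linarith [hs.2]⟩ (𝓕 u)
  have hu : Integrable fun x : 𝔼 => u (c • x) := u.integrable.comp_smul hc.ne'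
  rw [fracLap, integral_mul_fourierInv_eq hu hg, ← integral_smul]
  congr 1 with ξ
  rw [fourierInv_comp_smul _ hc.ne', finrank_euclideanSpace_fin, abs_of_pos (by positivity),
    smul_mul_assoc]

theorem integral_comp_inv_smul_mul_fracLap (hs : s ∈ Set.Icc (0 : ℝ) 1) (u : SchwartzMap 𝔼 ℂ)
    {c : ℝ} (hc : 0 < c) :
    ∫ x, u (c⁻¹ • x) * fracLap s u x =
      (c ^ ((N : ℝ) - 2 * s)) • ∫ x, u (c • x) * fracLap s u x := by
  rw [integral_comp_smul_mul_fracLap hs u hc, integral_comp_smul_mul_fracLap hs u (inv_pos.2 hc)]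
  have hscale := Measure.integral_comp_smul (volume : Measure 𝔼)
    (fun ξ => 𝓕 (⇑u) (c⁻¹ • -ξ) * ((‖ξ‖ ^ (2 * s) : ℝ) * 𝓕 (⇑u) ξ)) (-c)
  have hleft : ∀ ξ : 𝔼, 𝓕 (⇑u) (c⁻¹ • -(-c • ξ)) *
      ((‖-c • ξ‖ ^ (2 * s) : ℝ) * 𝓕 (⇑u) (-c • ξ)) =
      (c ^ (2 * s)) • (𝓕 (⇑u) (c⁻¹⁻¹ • -ξ) * ((‖ξ‖ ^ (2 * s) : ℝ) * 𝓕 (⇑u) ξ)) := by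
    intro ξ
    rw [neg_smul, neg_neg, inv_smul_smul₀ hc.ne', norm_neg, norm_smul, Real.norm_eq_abs,
      abs_of_pos hc, Real.mul_rpow hc.le (norm_nonneg _), inv_inv, smul_neg, Complex.real_smul]
    push_cast
    ring
  simp only [hleft] at hscale
  rw [integral_smul, finrank_euclideanSpace_fin, abs_inv, abs_pow, abs_neg, abs_of_pos hc]
    at hscale
  rw [← hscale, smul_smul, inv_pow, inv_inv, Real.rpow_sub hc, Real.rpow_natCast,
    div_mul_cancel₀ _ (Real.rpow_pos_of_pos hc _).ne']

end

/-- For Schwartz `u`, `∫ ⟨x, ∇u(x)⟩ (-Δ)^s u(x) dx = ((2s - N)/2) ∫ u (-Δ)^s u dx`. -/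
theorem stmt_7 (N : ℕ) (s : ℝ) (hs : s ∈ Set.Ioo (0 : ℝ) 1)
    (u : SchwartzMap (EuclideanSpace ℝ (Fin N)) ℂ) :
    ∫ x : EuclideanSpace ℝ (Fin N), (fderiv ℝ (⇑u) x x) * fracLap s (⇑u) x =
      (((2 * s - N) / 2 : ℝ) : ℂ) * ∫ x : EuclideanSpace ℝ (Fin N), u x * fracLap s (⇑u) x := by
  have hs' : s ∈ Set.Icc (0 : ℝ) 1 := Set.Ioo_subset_Icc_self hs
  have hg : Integrable fun ξ : EuclideanSpace ℝ (Fin N) =>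
      ((‖ξ‖ ^ (2 * s) : ℝ) : ℂ) * 𝓕 (⇑u) ξ :=
    integrable_norm_rpow_mul ⟨by linarith [hs'.1], by linarith [hs'.2]⟩ (𝓕 u)
  have hderiv := hasDerivAt_integral_comp_smul_mul u (w := fracLap s u)
    (continuous_fourierInv hg) (norm_fourierInv_le _)
  have hinv : HasDerivAt (fun c : ℝ => c⁻¹) (-1) 1 := by
    simpa using hasDerivAt_inv (one_ne_zero (α := ℝ))
  have hlhs := HasDerivAt.scomp_of_eq (1 : ℝ) hderiv hinv (by simp)
  have hpow : HasDerivAt (fun c : ℝ => c ^ ((N : ℝ) - 2 * s)) ((N : ℝ) - 2 * s) 1 := by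
    simpa using Real.hasDerivAt_rpow_const (x := 1) (p := (N : ℝ) - 2 * s) (Or.inl one_ne_zero)
  have hrhs := hpow.smul hderiv
  have heq := hlhs.unique (hrhs.congr_of_eventuallyEq <|
    (Filter.eventually_of_mem (Ioi_mem_nhds one_pos) fun c hc =>
      integral_comp_inv_smul_mul_fracLap hs' u hc))
  simp only [one_smul, Real.one_rpow, neg_smul, Complex.real_smul] at heq
  push_cast at heq ⊢
  linear_combination (-1 / 2 : ℂ) * heq
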